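/- Each of the operators e_1,…,e_n, f_1,…,f_n, k_1^{±1},…,k_n^{±1} on Λ commutes with each of the operators E, F, K^{±1} on Λ. -/

import Mathlib

noncomputable section

/-- The field `𝔽 = ℚ(q)`. -/
abbrev Fq : Type := RatFunc ℚ

/-- The quantum parameter `q`. -/
def qv : Fq := RatFunc.X

/-- The index set `I = {1,…,n} ∪ {−n,…,−1}` as a finset of integers. -/
def Iset (n : ℕ) : Finset ℤ := (Finset.Icc (-(n : ℤ)) (n : ℤ)).erase 0

/-- Subsets of `I`, the index type for the standard basis. -/
abbrev Bset (n : ℕ) : Type := {S : Finset ℤ // S ⊆ Iset n}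

/-- `Λ`, the free `𝔽`-vector space with basis `{v_S : S ⊆ I}`. -/
abbrev Lam (n : ℕ) : Type := Bset n →₀ Fq

/-- The standard basis vector `v_S`. -/
def bv (n : ℕ) (S : Bset n) : Lam n := Finsupp.single S 1

/-- The standard basis vector `v_T` for a finset `T ⊆ I` (and `0` for junk input). -/
def vS (n : ℕ) (T : Finset ℤ) : Lam n :=
  if h : T ⊆ Iset n then Finsupp.single (⟨T, h⟩ : Bset n) (1 : Fq) else 0

/-- The linear operator on `Λ` determined by prescribed values on the standard basis. -/
def mkOp (n : ℕ) (g : Bset n → Lam n) : Module.End Fq (Lam n) :=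
  Finsupp.linearCombination Fq g

/-- The four positions `{i, i+1, −i, −(i+1)}`. -/
def quad (i : ℤ) : Finset ℤ := {i, i + 1, -i, -(i + 1)}

/-- Value of `f_i` on `v_S`. -/
def fAct (n : ℕ) (i : ℤ) (S : Finset ℤ) : Lam n :=
  if i = (n : ℤ) then
    (if (n : ℤ) ∈ S ∧ -(n : ℤ) ∉ S then vS n (insert (-(n : ℤ)) (S.erase (n : ℤ))) else 0)
  else
    (if S ∩ quad i = {i} then vS n (insert (i + 1) (S.erase i))
     else if S ∩ quad i = {-(i + 1)} then vS n (insert (-i) (S.erase (-(i + 1))))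
     else if S ∩ quad i = ({i, -(i + 1)} : Finset ℤ) then
       vS n (insert (-i) (S.erase (-(i + 1)))) + qv⁻¹ • vS n (insert (i + 1) (S.erase i))
     else if S ∩ quad i = ({i, -i} : Finset ℤ) then qv • vS n (insert (i + 1) (S.erase i))
     else if S ∩ quad i = ({i + 1, -(i + 1)} : Finset ℤ) then
       vS n (insert (-i) (S.erase (-(i + 1))))
     else if S ∩ quad i = ({i, -(i + 1), -i} : Finset ℤ) then vS n (insert (i + 1) (S.erase i))
     else if S ∩ quad i = ({i, i + 1, -(i + 1)} : Finset ℤ) then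
       vS n (insert (-i) (S.erase (-(i + 1))))
     else 0)

/-- Value of `e_i` on `v_S`. -/
def eAct (n : ℕ) (i : ℤ) (S : Finset ℤ) : Lam n :=
  if i = (n : ℤ) then
    (if -(n : ℤ) ∈ S ∧ (n : ℤ) ∉ S then vS n (insert (n : ℤ) (S.erase (-(n : ℤ)))) else 0)
  else
    (if S ∩ quad i = {-i} then vS n (insert (-(i + 1)) (S.erase (-i)))
     else if S ∩ quad i = {i + 1} then vS n (insert i (S.erase (i + 1)))
     else if S ∩ quad i = ({i + 1, -i} : Finset ℤ) then
       vS n (insert i (S.erase (i + 1))) + qv⁻¹ • vS n (insert (-(i + 1)) (S.erase (-i)))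
     else if S ∩ quad i = ({i, -i} : Finset ℤ) then qv • vS n (insert (-(i + 1)) (S.erase (-i)))
     else if S ∩ quad i = ({i + 1, -(i + 1)} : Finset ℤ) then vS n (insert i (S.erase (i + 1)))
     else if S ∩ quad i = ({i, i + 1, -i} : Finset ℤ) then
       vS n (insert (-(i + 1)) (S.erase (-i)))
     else if S ∩ quad i = ({i + 1, -(i + 1), -i} : Finset ℤ) then vS n (insert i (S.erase (i + 1)))
     else 0)

/-- Coefficient of `ε_j` in `wt(S)`. -/
def epsCoef (S : Finset ℤ) (j : ℤ) : ℤ :=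
  (if j ∈ S then 1 else 0) - (if -j ∈ S then 1 else 0)

/-- The pairing `(α_i, wt S)`. -/
def alphaPair (n : ℕ) (i : ℤ) (S : Finset ℤ) : ℤ :=
  if i = (n : ℤ) then 2 * epsCoef S (n : ℤ) else epsCoef S i - epsCoef S (i + 1)

/-- The operator `f_i` on `Λ`. -/
def fop (n : ℕ) (i : ℤ) : Module.End Fq (Lam n) := mkOp n (fun S => fAct n i S.1)

/-- The operator `e_i` on `Λ`. -/
def eop (n : ℕ) (i : ℤ) : Module.End Fq (Lam n) := mkOp n (fun S => eAct n i S.1)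

/-- The operator `k_i` on `Λ`, `k_i · v_S = q^{(α_i, wt S)} v_S`. -/
def kop (n : ℕ) (i : ℤ) : Module.End Fq (Lam n) :=
  mkOp n (fun S => (qv ^ alphaPair n i S.1) • bv n S)

/-- The operator `k_i⁻¹` on `Λ`. -/
def kinvop (n : ℕ) (i : ℤ) : Module.End Fq (Lam n) :=
  mkOp n (fun S => (qv ^ (-alphaPair n i S.1)) • bv n S)

/-- `−S`. -/
def negSet (S : Finset ℤ) : Finset ℤ := S.image (fun x => -x)

/-- `S₀ = S ∩ (−S)`, the fully dotted columns. -/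
def Szero (S : Finset ℤ) : Finset ℤ := S ∩ negSet S

/-- `S₀^c = (I∖S) ∩ (−(I∖S))`, the undotted columns. -/
def Szeroc (n : ℕ) (S : Finset ℤ) : Finset ℤ := (Iset n \ S) ∩ negSet (Iset n \ S)

/-- `w(S) = (|S₀| − |S₀^c|)/2`. -/
def wTot (n : ℕ) (S : Finset ℤ) : ℤ :=
  (((Szero S).card : ℤ) - ((Szeroc n S).card : ℤ)) / 2

/-- `w_{>i}(S)`. -/
def wGt (n : ℕ) (i : ℤ) (S : Finset ℤ) : ℤ :=
  ((((Szero S).filter (fun x => i < |x| ∧ |x| ≤ (n : ℤ))).card : ℤ)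
    - (((Szeroc n S).filter (fun x => i < |x| ∧ |x| ≤ (n : ℤ))).card : ℤ)) / 2

/-- `w_{<i}(S)`. -/
def wLt (n : ℕ) (i : ℤ) (S : Finset ℤ) : ℤ :=
  ((((Szeroc n S).filter (fun x => x ≠ 0 ∧ |x| < i)).card : ℤ)
    - (((Szero S).filter (fun x => x ≠ 0 ∧ |x| < i)).card : ℤ)) / 2

/-- Value of `E` on `v_S`. -/
def EAct (n : ℕ) (S : Finset ℤ) : Lam n :=
  ∑ i ∈ (Finset.Icc (1 : ℤ) (n : ℤ)).filter (fun i => i ∈ Szeroc n S ∧ -i ∈ Szeroc n S),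
    ((-qv) ^ wGt n i S) • vS n (insert i (insert (-i) S))

/-- Value of `F` on `v_S`. -/
def FAct (n : ℕ) (S : Finset ℤ) : Lam n :=
  ∑ i ∈ (Finset.Icc (1 : ℤ) (n : ℤ)).filter (fun i => i ∈ Szero S ∧ -i ∈ Szero S),
    ((-qv) ^ wLt n i S) • vS n ((S.erase i).erase (-i))

/-- The operator `E` on `Λ`. -/
def Eop (n : ℕ) : Module.End Fq (Lam n) := mkOp n (fun S => EAct n S.1)

/-- The operator `F` on `Λ`. -/
def Fop (n : ℕ) : Module.End Fq (Lam n) := mkOp n (fun S => FAct n S.1)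

/-- The operator `K` on `Λ`, `K · v_S = (−q)^{w(S)} v_S`. -/
def Kop (n : ℕ) : Module.End Fq (Lam n) := mkOp n (fun S => ((-qv) ^ wTot n S.1) • bv n S)

/-- The operator `K⁻¹` on `Λ`. -/
def Kinvop (n : ℕ) : Module.End Fq (Lam n) :=
  mkOp n (fun S => ((-qv) ^ (-wTot n S.1)) • bv n S)

/-- Balanced quantum integer `[m]_x`. -/
def qNum (x : Fq) (m : ℕ) : Fq := (x ^ (m : ℤ) - x ^ (-(m : ℤ))) / (x - x⁻¹)

/-- Quantum factorial `[m]_x!`. -/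
def qFact (x : Fq) (m : ℕ) : Fq := ∏ j ∈ Finset.range m, qNum x (j + 1)

/-- Gaussian binomial coefficient in the variable `x`. -/
def qBinom (x : Fq) (m s : ℕ) : Fq := qFact x m / (qFact x s * qFact x (m - s))

/-- The variable `q_i`: `q` for `i < n` and `q²` for `i = n`. -/
def qsub (n : ℕ) (i : ℤ) : Fq := if i = (n : ℤ) then qv ^ 2 else qv

/-- The subring `A = ℤ[q,q⁻¹] ⊆ 𝔽`. -/
def Asub : Subring Fq := Subring.closure {qv, qv⁻¹}

/-- The `A`-lattice `Λ_A ⊆ Λ`: the `A`-span of all `v_S`. -/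
def LamA (n : ℕ) : Set (Lam n) :=
  {x | ∃ c : Bset n →₀ Fq, (∀ S, c S ∈ Asub) ∧ x = c.sum (fun S a => a • bv n S)}

/-- The degree-`k` part `Λ^k ⊆ Λ`. -/
def Lk (n k : ℕ) : Submodule Fq (Lam n) :=
  Submodule.span Fq {x | ∃ S : Bset n, S.1.card = k ∧ x = bv n S}

/-- The divided power `E^{(m)} = E^m/[m]!`. -/
def Ediv (n : ℕ) (m : ℕ) : Module.End Fq (Lam n) := (qFact qv m)⁻¹ • (Eop n ^ m)

/-- The divided power `F^{(m)} = F^m/[m]!`. -/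
def Fdiv (n : ℕ) (m : ℕ) : Module.End Fq (Lam n) := (qFact qv m)⁻¹ • (Fop n ^ m)

lemma vS_of_subset {n : ℕ} {T : Finset ℤ} (h : T ⊆ Iset n) : vS n T = bv n ⟨T, h⟩ := by
  simp [vS, bv, h]

lemma mem_Iset {n : ℕ} {x : ℤ} : x ∈ Iset n ↔ x ≠ 0 ∧ |x| ≤ n := by
  simp [Iset, abs_le]

lemma qv_ne_zero : qv ≠ 0 := RatFunc.X_ne_zero

/-! ### Operators sending basis vectors to multiples of basis vectors -/

/-- The operator sending `v_S` to `c S • v_{φ S}` if `p S` holds, and to `0` otherwise. -/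
def monoOp (n : ℕ) (p : Finset ℤ → Prop) [DecidablePred p] (c : Finset ℤ → Fq)
    (φ : Finset ℤ → Finset ℤ) : Module.End Fq (Lam n) :=
  mkOp n (fun S => if p S.1 then c S.1 • vS n (φ S.1) else 0)

lemma mkOp_vS {n : ℕ} (g : Bset n → Lam n) {S : Finset ℤ} (h : S ⊆ Iset n) :
    mkOp n g (vS n S) = g ⟨S, h⟩ := by
  simp [vS_of_subset h, mkOp, bv]

lemma end_ext {n : ℕ} {a b : Module.End Fq (Lam n)}
    (h : ∀ S ⊆ Iset n, a (vS n S) = b (vS n S)) : a = b := by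
  refine Finsupp.lhom_ext' fun S => LinearMap.ext_ring ?_
  have := h S.1 S.2
  rwa [vS_of_subset S.2] at this

lemma monoOp_vS {n : ℕ} {p : Finset ℤ → Prop} [DecidablePred p] {c : Finset ℤ → Fq}
    {φ : Finset ℤ → Finset ℤ} {S : Finset ℤ} (h : S ⊆ Iset n) :
    monoOp n p c φ (vS n S) = if p S then c S • vS n (φ S) else 0 :=
  mkOp_vS _ h

lemma monoOp_mul_vS {n : ℕ} {p r : Finset ℤ → Prop} [DecidablePred p] [DecidablePred r]
    {c d : Finset ℤ → Fq} {φ ψ : Finset ℤ → Finset ℤ} {S : Finset ℤ} (h : S ⊆ Iset n)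
    (hψ : r S → ψ S ⊆ Iset n) :
    (monoOp n p c φ * monoOp n r d ψ) (vS n S) =
      if r S ∧ p (ψ S) then (d S * c (ψ S)) • vS n (φ (ψ S)) else 0 := by
  rw [Module.End.mul_apply, monoOp_vS h]
  by_cases hr : r S
  · simp only [hr, if_true, true_and, map_smul, monoOp_vS (hψ hr)]
    split_ifs <;> simp [mul_smul]
  · simp [hr]

lemma commute_monoOp {n : ℕ} {p r : Finset ℤ → Prop} [DecidablePred p] [DecidablePred r]
    {c d : Finset ℤ → Fq} {φ ψ : Finset ℤ → Finset ℤ}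
    (hφ : ∀ S ⊆ Iset n, p S → φ S ⊆ Iset n) (hψ : ∀ S ⊆ Iset n, r S → ψ S ⊆ Iset n)
    (h : ∀ S ⊆ Iset n, (r S ∧ p (ψ S) ↔ p S ∧ r (φ S)))
    (hv : ∀ S ⊆ Iset n, r S → p (ψ S) → p S → r (φ S) →
      φ (ψ S) = ψ (φ S) ∧ d S * c (ψ S) = c S * d (φ S)) :
    Commute (monoOp n p c φ) (monoOp n r d ψ) := by
  refine end_ext fun S hS => ?_
  rw [monoOp_mul_vS hS (hψ S hS), monoOp_mul_vS hS (hφ S hS)]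
  have h1 := h S hS
  by_cases h2 : r S ∧ p (ψ S)
  · have h3 := h1.1 h2
    obtain ⟨h4, h5⟩ := hv S hS h2.1 h2.2 h3.1 h3.2
    rw [if_pos h2, if_pos h3, h4, h5]
  · rw [if_neg h2, if_neg (h1.not.1 h2)]

/-- The diagonal operator scaling `v_S` by `c S`. -/
def diagOp (n : ℕ) (c : Finset ℤ → Fq) : Module.End Fq (Lam n) :=
  monoOp n (fun _ => True) c id

lemma commute_diagOp_monoOp {n : ℕ} {r : Finset ℤ → Prop} [DecidablePred r]
    {c d : Finset ℤ → Fq} {ψ : Finset ℤ → Finset ℤ} (hψ : ∀ S ⊆ Iset n, r S → ψ S ⊆ Iset n)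
    (h : ∀ S ⊆ Iset n, r S → c (ψ S) = c S) :
    Commute (diagOp n c) (monoOp n r d ψ) :=
  commute_monoOp (fun _ hS _ => hS) hψ (fun S _ => by simp)
    (fun S hS hr _ _ _ => by simp [h S hS hr, mul_comm])

lemma mkOp_smul_bv (n : ℕ) (c : Finset ℤ → Fq) :
    mkOp n (fun S => c S.1 • bv n S) = diagOp n c := by
  simp only [diagOp, monoOp, if_true]
  congr 1
  ext1 S
  rw [id, vS_of_subset S.2]

lemma mkOp_add {n : ℕ} (g h : Bset n → Lam n) :
    mkOp n (fun S => g S + h S) = mkOp n g + mkOp n h :=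
  end_ext fun S hS => by simp [mkOp_vS _ hS]

lemma mkOp_sum {n : ℕ} {ι : Type*} (s : Finset ι) (g : ι → Bset n → Lam n) :
    mkOp n (fun S => ∑ j ∈ s, g j S) = ∑ j ∈ s, mkOp n (g j) :=
  end_ext fun S hS => by simp [mkOp_vS _ hS, LinearMap.sum_apply]

/-! ### The weights as counting functions -/

/-- The number of elements of `S` satisfying `p`, as an integer. -/
def countIn (p : ℤ → Prop) [DecidablePred p] (S : Finset ℤ) : ℤ := (S.filter p).card

lemma countIn_insert {p : ℤ → Prop} [DecidablePred p] {S : Finset ℤ} {x : ℤ} (hx : x ∉ S) :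
    countIn p (insert x S) = countIn p S + if p x then 1 else 0 := by
  unfold countIn
  rw [Finset.filter_insert]
  split_ifs
  · rw [Finset.card_insert_of_notMem (by simp [hx])]; simp
  · simp

lemma countIn_erase {p : ℤ → Prop} [DecidablePred p] {S : Finset ℤ} {x : ℤ} (hx : x ∈ S) :
    countIn p (S.erase x) = countIn p S - if p x then 1 else 0 := by
  have := countIn_insert (p := p) (Finset.notMem_erase x S)
  rw [Finset.insert_erase hx] at this
  omega

lemma mem_negSet {S : Finset ℤ} {x : ℤ} : x ∈ negSet S ↔ -x ∈ S := by
  simp [negSet, neg_eq_iff_eq_neg]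

lemma mem_Szero {S : Finset ℤ} {x : ℤ} : x ∈ Szero S ↔ x ∈ S ∧ -x ∈ S := by
  simp [Szero, mem_negSet]

lemma mem_Szeroc {n : ℕ} {S : Finset ℤ} {x : ℤ} :
    x ∈ Szeroc n S ↔ x ∈ Iset n ∧ x ∉ S ∧ -x ∉ S := by
  simp only [Szeroc, mem_negSet, Finset.mem_inter, Finset.mem_sdiff, mem_Iset, abs_neg]
  grind

lemma card_Szero_sub_card_Szeroc {n : ℕ} {S : Finset ℤ} (hS : S ⊆ Iset n) (p : ℤ → Prop)
    [DecidablePred p] (hp : ∀ x, p (-x) ↔ p x) :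
    (((Szero S).filter p).card : ℤ) - ((Szeroc n S).filter p).card =
      2 * countIn p S - countIn p (Iset n) := by
  have h1 := Finset.card_union_add_card_inter (S.filter p) (negSet (S.filter p))
  have h2 : (negSet (S.filter p)).card = (S.filter p).card :=
    Finset.card_image_of_injective _ neg_injective
  have h3 : S.filter p ∩ negSet (S.filter p) = (Szero S).filter p := by
    ext x; simp only [Finset.mem_inter, mem_negSet, Finset.mem_filter, mem_Szero, hp]; tauto
  have h4 : (Szeroc n S).filter p = (Iset n).filter p \ (S.filter p ∪ negSet (S.filter p)) := by
    ext x
    simp only [Finset.mem_union, mem_negSet, Finset.mem_filter, mem_Szeroc, hp, Finset.mem_sdiff]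
    tauto
  have h5 : S.filter p ∪ negSet (S.filter p) ⊆ (Iset n).filter p := by
    intro x
    have ha := @hS x
    have hb := @hS (-x)
    simp only [mem_Iset, abs_neg, neg_ne_zero] at ha hb
    simp only [Finset.mem_union, mem_negSet, Finset.mem_filter, mem_Iset, hp]
    tauto
  have h6 := Finset.card_sdiff_add_card_eq_card h5
  rw [h3, h2] at h1
  rw [← h4] at h6
  unfold countIn
  omega

lemma wTot_eq {n : ℕ} {S : Finset ℤ} (hS : S ⊆ Iset n) :
    wTot n S = countIn (fun _ => True) S - n := by
  have h := card_Szero_sub_card_Szeroc hS (fun _ => True) (by simp)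
  have hI : countIn (fun _ => True) (Iset n) = 2 * n := by
    simp [countIn, Iset]
    omega
  simp only [Finset.filter_true] at h
  rw [wTot, h, hI]
  omega

lemma wGt_eq {n : ℕ} {S : Finset ℤ} (hS : S ⊆ Iset n) {j : ℤ} (h0 : 0 ≤ j) (hj : j ≤ n) :
    wGt n j S = countIn (fun x => j < |x| ∧ |x| ≤ n) S - (n - j) := by
  have h := card_Szero_sub_card_Szeroc hS (fun x => j < |x| ∧ |x| ≤ n) (by simp)
  have hI : countIn (fun x => j < |x| ∧ |x| ≤ n) (Iset n) = 2 * (n - j) := by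
    have : (Iset n).filter (fun x => j < |x| ∧ |x| ≤ n) =
        Finset.Ioc j n ∪ Finset.Ico (-n : ℤ) (-j) := by
      ext x
      simp only [Finset.mem_filter, mem_Iset, Finset.mem_union, Finset.mem_Ioc, Finset.mem_Ico]
      grind
    rw [countIn, this, Finset.card_union_of_disjoint]
    · simp; omega
    · rw [Finset.disjoint_left]; intro x; simp; omega
  rw [wGt, h, hI]
  omega

lemma wLt_eq {n : ℕ} {S : Finset ℤ} (hS : S ⊆ Iset n) {j : ℤ} (h0 : 1 ≤ j) (hj : j ≤ n) :
    wLt n j S = j - 1 - countIn (fun x => x ≠ 0 ∧ |x| < j) S := by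
  have h := card_Szero_sub_card_Szeroc hS (fun x => x ≠ 0 ∧ |x| < j) (by simp)
  have hI : countIn (fun x => x ≠ 0 ∧ |x| < j) (Iset n) = 2 * (j - 1) := by
    have : (Iset n).filter (fun x => x ≠ 0 ∧ |x| < j) =
        (Finset.Icc (1 - j) (j - 1)).erase 0 := by
      ext x
      simp only [Finset.mem_filter, mem_Iset, Finset.mem_erase, Finset.mem_Icc]
      grind
    rw [countIn, this, Finset.card_erase_of_mem (by simp; omega)]
    simp; omega
  rw [wLt]
  omega

/-! ### Elementary summands of the operators -/

/-- The operator replacing `x ∈ S` by `y ∉ S`, with coefficient `c S`. -/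
def shiftOp (n : ℕ) (x y : ℤ) (c : Finset ℤ → Fq) : Module.End Fq (Lam n) :=
  monoOp n (fun S => x ∈ S ∧ y ∉ S) c (fun S => insert y (S.erase x))

/-- The `j`-th summand of `E`. -/
def pairInsertOp (n : ℕ) (j : ℤ) : Module.End Fq (Lam n) :=
  monoOp n (fun S => j ∉ S ∧ -j ∉ S) (fun S => (-qv) ^ wGt n j S)
    (fun S => insert j (insert (-j) S))

/-- The `j`-th summand of `F`. -/
def pairEraseOp (n : ℕ) (j : ℤ) : Module.End Fq (Lam n) :=
  monoOp n (fun S => j ∈ S ∧ -j ∈ S) (fun S => (-qv) ^ wLt n j S)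
    (fun S => (S.erase j).erase (-j))

/-- The coefficient `q^{[-x ∈ S] - [-y ∈ S]}`. -/
def shiftCoef (x y : ℤ) (S : Finset ℤ) : Fq :=
  qv ^ ((if -x ∈ S then 1 else 0) - (if -y ∈ S then 1 else 0) : ℤ)

lemma Eop_eq_sum (n : ℕ) : Eop n = ∑ j ∈ Finset.Icc (1 : ℤ) n, pairInsertOp n j := by
  unfold pairInsertOp monoOp
  rw [← mkOp_sum]
  unfold Eop EAct
  congr 1
  ext1 S
  rw [Finset.sum_filter]
  refine Finset.sum_congr rfl fun j hj => ?_
  have : j ∈ Szeroc n S.1 ∧ -j ∈ Szeroc n S.1 ↔ j ∉ S.1 ∧ -j ∉ S.1 := by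
    simp only [mem_Szeroc, mem_Iset, abs_neg, neg_neg]
    grind
  simp only [this]

lemma Fop_eq_sum (n : ℕ) : Fop n = ∑ j ∈ Finset.Icc (1 : ℤ) n, pairEraseOp n j := by
  unfold pairEraseOp monoOp
  rw [← mkOp_sum]
  unfold Fop FAct
  congr 1
  ext1 S
  rw [Finset.sum_filter]
  refine Finset.sum_congr rfl fun j hj => ?_
  have : j ∈ Szero S.1 ∧ -j ∈ Szero S.1 ↔ j ∈ S.1 ∧ -j ∈ S.1 := by
    simp only [mem_Szero, neg_neg]
    tauto
  simp only [this]

lemma inter_eq_iff {S Q X : Finset ℤ} (hX : X ⊆ Q) :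
    S ∩ Q = X ↔ ∀ x ∈ Q, (x ∈ S ↔ x ∈ X) := by
  rw [Finset.ext_iff]
  simp only [Finset.mem_inter]
  grind

lemma fop_eq_of_lt {n : ℕ} {i : ℤ} (h1 : 1 ≤ i) (hi : i < n) :
    fop n i = shiftOp n i (i + 1) (shiftCoef i (i + 1)) +
      shiftOp n (-(i + 1)) (-i) (fun _ => 1) := by
  unfold shiftOp monoOp
  rw [← mkOp_add]
  unfold fop fAct shiftCoef
  congr 1
  ext1 S
  rw [if_neg hi.ne]
  have d1 : i + 1 ≠ -(i + 1) := by omega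
  have d2 : i ≠ -(i + 1) := by omega
  have d3 : i ≠ -i := by omega
  have d4 : i + 1 ≠ -i := by omega
  have d5 : -i ≠ -(i + 1) := by omega
  have d6 : i ≠ i + 1 := by omega
  simp (disch := grind [quad]) only [inter_eq_iff]
  simp only [quad, Finset.mem_insert, Finset.mem_singleton, forall_eq_or_imp, forall_eq,
    d1, d2, d3, d4, d5, d6, d1.symm, d2.symm, d3.symm, d4.symm, d5.symm, d6.symm]
  by_cases m1 : i ∈ S.1 <;> by_cases m2 : i + 1 ∈ S.1 <;> by_cases m3 : -i ∈ S.1 <;>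
    by_cases m4 : -(i + 1) ∈ S.1 <;> simp only [m1, m2, m3, m4] <;> simp [add_comm]

lemma eop_eq_of_lt {n : ℕ} {i : ℤ} (h1 : 1 ≤ i) (hi : i < n) :
    eop n i = shiftOp n (-i) (-(i + 1)) (shiftCoef (-i) (-(i + 1))) +
      shiftOp n (- -(i + 1)) (- -i) (fun _ => 1) := by
  unfold shiftOp monoOp
  rw [← mkOp_add]
  unfold eop eAct shiftCoef
  congr 1
  ext1 S
  rw [if_neg hi.ne]
  have d1 : i + 1 ≠ -(i + 1) := by omega
  have d2 : i ≠ -(i + 1) := by omega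
  have d3 : i ≠ -i := by omega
  have d4 : i + 1 ≠ -i := by omega
  have d5 : -i ≠ -(i + 1) := by omega
  have d6 : i ≠ i + 1 := by omega
  simp (disch := grind [quad]) only [inter_eq_iff]
  simp only [quad, Finset.mem_insert, Finset.mem_singleton, forall_eq_or_imp, forall_eq, neg_neg,
    d1, d2, d3, d4, d5, d6, d1.symm, d2.symm, d3.symm, d4.symm, d5.symm, d6.symm]
  by_cases m1 : i ∈ S.1 <;> by_cases m2 : i + 1 ∈ S.1 <;> by_cases m3 : -i ∈ S.1 <;>
    by_cases m4 : -(i + 1) ∈ S.1 <;> simp only [m1, m2, m3, m4] <;> simp [add_comm]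

lemma fop_last (n : ℕ) : fop n n = shiftOp n n (-n) (fun _ => 1) := by
  simp [fop, fAct, shiftOp, monoOp]

lemma eop_last (n : ℕ) : eop n n = shiftOp n (-n) (- -n) (fun _ => 1) := by
  simp [eop, eAct, shiftOp, monoOp]

lemma insert_erase_subset {n : ℕ} {x y : ℤ} (hy : y ∈ Iset n) {S : Finset ℤ} (hS : S ⊆ Iset n) :
    insert y (S.erase x) ⊆ Iset n :=
  Finset.insert_subset hy ((Finset.erase_subset _ _).trans hS)

lemma insert_pair_subset {n : ℕ} {j : ℤ} (h1 : 1 ≤ j) (hj : j ≤ n) {S : Finset ℤ}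
    (hS : S ⊆ Iset n) : insert j (insert (-j) S) ⊆ Iset n := by
  refine Finset.insert_subset ?_ (Finset.insert_subset ?_ hS) <;> rw [mem_Iset] <;> grind

lemma erase_pair_subset {n : ℕ} {j : ℤ} {S : Finset ℤ} (hS : S ⊆ Iset n) :
    (S.erase j).erase (-j) ⊆ Iset n :=
  (Finset.erase_subset _ _).trans ((Finset.erase_subset _ _).trans hS)

lemma countIn_insert_erase {p : ℤ → Prop} [DecidablePred p] {S : Finset ℤ} {x y : ℤ} (hx : x ∈ S)
    (hy : y ∉ S) : countIn p (insert y (S.erase x)) =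
      countIn p S - (if p x then 1 else 0) + if p y then 1 else 0 := by
  rw [countIn_insert (by simp [hy]), countIn_erase hx]

/-! ### Commutation of the elementary summands -/

lemma commute_diagOp_shiftOp {n : ℕ} {x y : ℤ} (hy : y ∈ Iset n) {c d : Finset ℤ → Fq}
    (h : ∀ S ⊆ Iset n, x ∈ S → y ∉ S → c (insert y (S.erase x)) = c S) :
    Commute (diagOp n c) (shiftOp n x y d) :=
  commute_diagOp_monoOp (fun _ hS _ => insert_erase_subset hy hS)
    (fun S hS hr => h S hS hr.1 hr.2)

lemma wTot_insert_erase {n : ℕ} {x y : ℤ} (hy : y ∈ Iset n) {S : Finset ℤ} (hS : S ⊆ Iset n)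
    (hxS : x ∈ S) (hyS : y ∉ S) : wTot n (insert y (S.erase x)) = wTot n S := by
  rw [wTot_eq (insert_erase_subset hy hS), wTot_eq hS, countIn_insert_erase hxS hyS]
  simp

lemma alphaPair_insert_pair {n : ℕ} {i j : ℤ} {S : Finset ℤ} (h : j ∉ S) (h' : -j ∉ S) :
    alphaPair n i (insert j (insert (-j) S)) = alphaPair n i S := by
  have key (k : ℤ) : epsCoef (insert j (insert (-j) S)) k = epsCoef S k := by
    unfold epsCoef
    grind
  simp [alphaPair, key]

lemma alphaPair_erase_pair {n : ℕ} {i j : ℤ} {S : Finset ℤ} (h : j ∈ S) (h' : -j ∈ S) :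
    alphaPair n i ((S.erase j).erase (-j)) = alphaPair n i S := by
  have key (k : ℤ) : epsCoef ((S.erase j).erase (-j)) k = epsCoef S k := by
    unfold epsCoef
    grind
  simp [alphaPair, key]

lemma commute_diagOp_Eop {n : ℕ} {c : Finset ℤ → Fq}
    (h : ∀ (j : ℤ) (S : Finset ℤ), j ∉ S → -j ∉ S → c (insert j (insert (-j) S)) = c S) :
    Commute (diagOp n c) (Eop n) := by
  rw [Eop_eq_sum]
  refine Commute.sum_right _ _ _ fun j hj => ?_
  rw [Finset.mem_Icc] at hj
  exact commute_diagOp_monoOp (fun _ hS _ => insert_pair_subset hj.1 hj.2 hS)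
    (fun S _ hr => h j S hr.1 hr.2)

lemma commute_diagOp_Fop {n : ℕ} {c : Finset ℤ → Fq}
    (h : ∀ (j : ℤ) (S : Finset ℤ), j ∈ S → -j ∈ S → c ((S.erase j).erase (-j)) = c S) :
    Commute (diagOp n c) (Fop n) := by
  rw [Fop_eq_sum]
  refine Commute.sum_right _ _ _ fun j _ => ?_
  exact commute_diagOp_monoOp (fun _ hS _ => erase_pair_subset hS)
    (fun S _ hr => h j S hr.1 hr.2)

lemma commute_diagOp_diagOp {n : ℕ} (c d : Finset ℤ → Fq) :
    Commute (diagOp n c) (diagOp n d) :=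
  commute_diagOp_monoOp (fun _ hS _ => hS) (fun _ _ _ => rfl)

/-- A shift commutes with the insertion of a pair in a different column. -/
lemma commute_shiftOp_pairInsertOp {n : ℕ} {x y j : ℤ} (hy : y ∈ Iset n) (h1 : 1 ≤ j)
    (hj : j ≤ n) {c : Finset ℤ → Fq} (hjx : j ≠ |x|) (hjy : j ≠ |y|) (hx : |x| ≤ n)
    (hxy : j < |x| ↔ j < |y|) (hc : ∀ S, c (insert j (insert (-j) S)) = c S) :
    Commute (shiftOp n x y c) (pairInsertOp n j) := by
  have hx1 : j ≠ x := by grind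
  have hx2 : -j ≠ x := by grind
  have hy1 : j ≠ y := by grind
  have hy2 : -j ≠ y := by grind
  have hyn := (mem_Iset.1 hy).2
  refine commute_monoOp (fun _ hS _ => insert_erase_subset hy hS)
    (fun _ hS _ => insert_pair_subset h1 hj hS) (fun S _ => by grind) fun S hS _ _ hp _ => ?_
  constructor
  · ext; grind
  · rw [hc, wGt_eq (insert_erase_subset hy hS) (by omega) hj, wGt_eq hS (by omega) hj,
      countIn_insert_erase hp.1 hp.2, mul_comm]
    simp [hx, hyn, hxy]

/-- A shift with target in a column is annihilated by the insertion of a pair in that column. -/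
lemma commute_shiftOp_pairInsertOp_target {n : ℕ} {x y j : ℤ} (hy : y ∈ Iset n) (h1 : 1 ≤ j)
    (hj : j ≤ n) {c : Finset ℤ → Fq} (hjy : j = |y|) :
    Commute (shiftOp n x y c) (pairInsertOp n j) := by
  have hy' : y = j ∨ y = -j := by grind
  exact commute_monoOp (fun _ hS _ => insert_erase_subset hy hS)
    (fun _ hS _ => insert_pair_subset h1 hj hS) (fun S _ => by grind) fun S _ _ _ _ _ => by grind

/-- A shift commutes with the removal of a pair in a different column. -/
lemma commute_shiftOp_pairEraseOp {n : ℕ} {x y j : ℤ} (hx0 : x ≠ 0) (hy : y ∈ Iset n)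
    (h1 : 1 ≤ j) (hj : j ≤ n) {c : Finset ℤ → Fq} (hjx : j ≠ |x|) (hjy : j ≠ |y|)
    (hxy : |x| < j ↔ |y| < j) (hc : ∀ S, c ((S.erase j).erase (-j)) = c S) :
    Commute (shiftOp n x y c) (pairEraseOp n j) := by
  have hx1 : j ≠ x := by grind
  have hx2 : -j ≠ x := by grind
  have hy1 : j ≠ y := by grind
  have hy2 : -j ≠ y := by grind
  have hy0 := (mem_Iset.1 hy).1
  refine commute_monoOp (fun _ hS _ => insert_erase_subset hy hS)
    (fun _ hS _ => erase_pair_subset hS) (fun S _ => by grind) fun S hS _ _ hp _ => ?_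
  constructor
  · ext; grind
  · rw [hc, wLt_eq (insert_erase_subset hy hS) h1 hj, wLt_eq hS h1 hj,
      countIn_insert_erase hp.1 hp.2, mul_comm]
    simp [hx0, hy0, hxy]

/-- A shift with source in a column is annihilated by the removal of a pair in that column. -/
lemma commute_shiftOp_pairEraseOp_source {n : ℕ} {x y j : ℤ} (hy : y ∈ Iset n)
    {c : Finset ℤ → Fq} (hjx : j = |x|) :
    Commute (shiftOp n x y c) (pairEraseOp n j) := by
  have hx' : x = j ∨ x = -j := by grind
  exact commute_monoOp (fun _ hS _ => insert_erase_subset hy hS)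
    (fun _ hS _ => erase_pair_subset hS) (fun S _ => by grind) fun S _ _ _ _ _ => by grind

/-! ### The two-column computations -/

lemma countIn_eq_add {p r : ℤ → Prop} [DecidablePred p] [DecidablePred r] {a b : ℤ}
    (h : ∀ z, r z ↔ p z ∨ z = a ∨ z = b) (hab : a ≠ b) (ha : ¬ p a) (hb : ¬ p b)
    (S : Finset ℤ) :
    countIn r S = countIn p S + (if a ∈ S then 1 else 0) + if b ∈ S then 1 else 0 := by
  induction S using Finset.induction with
  | empty => simp [countIn]
  | insert x S hx ih =>
    rw [countIn_insert hx, countIn_insert hx, ih]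
    simp only [h, Finset.mem_insert]
    grind

lemma wGt_eq_wGt_succ {n : ℕ} {S : Finset ℤ} (hS : S ⊆ Iset n) {i : ℤ} (h1 : 1 ≤ i)
    (hi : i < n) : wGt n i S =
      wGt n (i + 1) S + (if i + 1 ∈ S then 1 else 0) + (if -(i + 1) ∈ S then 1 else 0) - 1 := by
  rw [wGt_eq hS (by omega) hi.le, wGt_eq hS (by omega) (by omega),
    countIn_eq_add (r := fun x => i < |x| ∧ |x| ≤ n) (p := fun x => i + 1 < |x| ∧ |x| ≤ n)
      (a := i + 1) (b := -(i + 1)) (by grind) (by omega) (by grind) (by grind)]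
  ring

lemma wLt_succ_eq_wLt {n : ℕ} {S : Finset ℤ} (hS : S ⊆ Iset n) {i : ℤ} (h1 : 1 ≤ i)
    (hi : i < n) : wLt n (i + 1) S =
      wLt n i S - (if i ∈ S then 1 else 0) - (if -i ∈ S then 1 else 0) + 1 := by
  rw [wLt_eq hS h1 hi.le, wLt_eq hS (by omega) (by omega),
    countIn_eq_add (r := fun x => x ≠ 0 ∧ |x| < i + 1) (p := fun x => x ≠ 0 ∧ |x| < i)
      (a := i) (b := -i) (by grind) (by omega) (by grind) (by grind)]
  ring

lemma wGt_insert_erase {n : ℕ} {x y j : ℤ} (hy : y ∈ Iset n) (hx : x ∈ Iset n) {S : Finset ℤ}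
    (hS : S ⊆ Iset n) (h0 : 0 ≤ j) (hj : j ≤ n) (hxS : x ∈ S) (hyS : y ∉ S) :
    wGt n j (insert y (S.erase x)) =
      wGt n j S - (if j < |x| then 1 else 0) + if j < |y| then 1 else 0 := by
  rw [wGt_eq (insert_erase_subset hy hS) h0 hj, wGt_eq hS h0 hj, countIn_insert_erase hxS hyS]
  simp only [(mem_Iset.1 hx).2, (mem_Iset.1 hy).2, and_true]
  ring

lemma wLt_insert_erase {n : ℕ} {x y j : ℤ} (hy : y ∈ Iset n) (hx : x ∈ Iset n) {S : Finset ℤ}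
    (hS : S ⊆ Iset n) (h0 : 1 ≤ j) (hj : j ≤ n) (hxS : x ∈ S) (hyS : y ∉ S) :
    wLt n j (insert y (S.erase x)) =
      wLt n j S + (if |x| < j then 1 else 0) - if |y| < j then 1 else 0 := by
  rw [wLt_eq (insert_erase_subset hy hS) h0 hj, wLt_eq hS h0 hj, countIn_insert_erase hxS hyS]
  simp only [(mem_Iset.1 hx).1, (mem_Iset.1 hy).1, ne_eq, not_false_eq_true, true_and]
  ring

lemma neg_qv_zpow_add_one (m : ℤ) : (-qv) ^ (m + 1) = -(qv * (-qv) ^ m) := by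
  rw [zpow_add_one₀ (neg_ne_zero.2 qv_ne_zero)]
  ring

lemma neg_qv_zpow_sub_one (m : ℤ) : (-qv) ^ (m - 1) = -(qv⁻¹ * (-qv) ^ m) := by
  rw [zpow_sub_one₀ (neg_ne_zero.2 qv_ne_zero), inv_neg]
  ring

lemma qv_inv_mul_cancel (a : Fq) : qv⁻¹ * (qv * a) = a :=
  inv_mul_cancel_left₀ qv_ne_zero a

lemma qv_inv_mul_mul_cancel (a : Fq) : qv⁻¹ * a * qv = a := by
  rw [mul_assoc, mul_comm a, qv_inv_mul_cancel]

lemma lie_shiftOp_pairInsertOp {n : ℕ} {i x y : ℤ} (h1 : 1 ≤ i) (hi : i < n)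
    (hxy : x = i ∧ y = i + 1 ∨ x = -i ∧ y = -(i + 1)) :
    ⁅shiftOp n x y (shiftCoef x y), pairInsertOp n i⁆ +
      ⁅shiftOp n (-y) (-x) (fun _ => 1), pairInsertOp n (i + 1)⁆ = 0 := by
  refine end_ext fun S hS => ?_
  have hx : x ∈ Iset n := mem_Iset.2 (by grind)
  have hy : y ∈ Iset n := mem_Iset.2 (by grind)
  have hx' : -x ∈ Iset n := mem_Iset.2 (by grind)
  have hy' : -y ∈ Iset n := mem_Iset.2 (by grind)
  have hxi (U : Finset ℤ) : insert i (insert (-i) U) = insert x (insert (-x) U) := by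
    ext; grind
  have hyi (U : Finset ℤ) :
      insert (i + 1) (insert (-(i + 1)) U) = insert y (insert (-y) U) := by
    ext; grind
  have hxm (U : Finset ℤ) : (i ∉ U ∧ -i ∉ U) ↔ (x ∉ U ∧ -x ∉ U) := by grind
  have hym (U : Finset ℤ) : (i + 1 ∉ U ∧ -(i + 1) ∉ U) ↔ (y ∉ U ∧ -y ∉ U) := by grind
  have hw : wGt n i S = wGt n (i + 1) S + (if y ∈ S then 1 else 0) +
      (if -y ∈ S then 1 else 0) - 1 := by
    rw [wGt_eq_wGt_succ hS h1 hi]; grind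
  have hax : |x| = i := by grind
  have hay : |y| = i + 1 := by grind
  have d1 : x ≠ y := by grind
  have d2 : -x ≠ y := by grind
  have d3 : x ≠ -x := by grind
  have d4 : y ≠ -y := by grind
  have d5 : x ≠ -y := by grind
  simp only [Ring.lie_def, LinearMap.add_apply, LinearMap.sub_apply, shiftOp, pairInsertOp]
  rw [monoOp_mul_vS hS (fun _ => insert_pair_subset h1 hi.le hS),
    monoOp_mul_vS hS (fun _ => insert_erase_subset hy hS),
    monoOp_mul_vS hS (fun _ => insert_pair_subset (by omega) (by omega) hS),
    monoOp_mul_vS hS (fun _ => insert_erase_subset hx' hS)]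
  simp only [hxi, hyi, hxm, hym]
  clear hxi hyi hxm hym
  by_cases hyS : y ∈ S
  · simp [hyS, d1, d1.symm, d2.symm, d4]
  by_cases hxS' : -x ∈ S
  · simp [hxS', d2, d3.symm]
  have hT2 (h : x ∈ S) : insert x (insert (-x) (insert y (S.erase x))) =
      insert y (insert (-x) S) := by ext; grind
  have hT3 (h : -y ∉ S) : insert (-x) ((insert y (insert (-y) S)).erase (-y)) =
      insert y (insert (-x) S) := by ext; grind
  have hT4 (h : -y ∈ S) : insert y (insert (-y) (insert (-x) (S.erase (-y)))) =
      insert y (insert (-x) S) := by ext; grind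
  have hwA (h : x ∈ S) := wGt_insert_erase hy hx hS (by omega : 0 ≤ i) hi.le h hyS
  have hwB (h : -y ∈ S) :=
    wGt_insert_erase hx' hy' hS (by omega : 0 ≤ i + 1) (by omega) h hxS'
  by_cases hxS : x ∈ S <;> by_cases hyS' : -y ∈ S <;>
    simp [hyS, hxS', hxS, hyS', d1, d1.symm, d2, d2.symm, d3, d3.symm, d4, d4.symm, d5.symm, hT2,
      hT3, hT4, shiftCoef, qv_inv_mul_cancel, qv_inv_mul_mul_cancel, hwA, hwB,
      hw, hax, hay, neg_qv_zpow_add_one, neg_qv_zpow_sub_one]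

lemma lie_shiftOp_pairEraseOp {n : ℕ} {i x y : ℤ} (h1 : 1 ≤ i) (hi : i < n)
    (hxy : x = i ∧ y = i + 1 ∨ x = -i ∧ y = -(i + 1)) :
    ⁅shiftOp n x y (shiftCoef x y), pairEraseOp n (i + 1)⁆ +
      ⁅shiftOp n (-y) (-x) (fun _ => 1), pairEraseOp n i⁆ = 0 := by
  refine end_ext fun S hS => ?_
  have hx : x ∈ Iset n := mem_Iset.2 (by grind)
  have hy : y ∈ Iset n := mem_Iset.2 (by grind)
  have hx' : -x ∈ Iset n := mem_Iset.2 (by grind)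
  have hy' : -y ∈ Iset n := mem_Iset.2 (by grind)
  have hxi (U : Finset ℤ) : (U.erase i).erase (-i) = (U.erase x).erase (-x) := by
    ext; grind
  have hyi (U : Finset ℤ) :
      (U.erase (i + 1)).erase (-(i + 1)) = (U.erase y).erase (-y) := by
    ext; grind
  have hxm (U : Finset ℤ) : (i ∈ U ∧ -i ∈ U) ↔ (x ∈ U ∧ -x ∈ U) := by grind
  have hym (U : Finset ℤ) : (i + 1 ∈ U ∧ -(i + 1) ∈ U) ↔ (y ∈ U ∧ -y ∈ U) := by grind
  have hw : wLt n (i + 1) S = wLt n i S - (if x ∈ S then 1 else 0) -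
      (if -x ∈ S then 1 else 0) + 1 := by
    rw [wLt_succ_eq_wLt hS h1 hi]; grind
  have hax : |x| = i := by grind
  have hay : |y| = i + 1 := by grind
  have d1 : x ≠ y := by grind
  have d2 : -x ≠ y := by grind
  have d3 : x ≠ -x := by grind
  have d4 : y ≠ -y := by grind
  have d5 : x ≠ -y := by grind
  simp only [Ring.lie_def, LinearMap.add_apply, LinearMap.sub_apply, shiftOp, pairEraseOp]
  rw [monoOp_mul_vS hS (fun _ => erase_pair_subset hS),
    monoOp_mul_vS hS (fun _ => insert_erase_subset hy hS),
    monoOp_mul_vS hS (fun _ => erase_pair_subset hS),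
    monoOp_mul_vS hS (fun _ => insert_erase_subset hx' hS)]
  simp only [hxi, hyi, hxm, hym]
  clear hxi hyi hxm hym
  by_cases hxS : x ∉ S
  · simp [hxS, d1, d3]
  by_cases hyS' : -y ∉ S
  · simp [hyS', d1, d4.symm]
  rw [not_not] at hxS hyS'
  have hT1 (h : y ∈ S) : insert y (((S.erase y).erase (-y)).erase x) =
      (S.erase x).erase (-y) := by ext; grind
  have hT3 (h : -x ∈ S) : insert (-x) (((S.erase x).erase (-x)).erase (-y)) =
      (S.erase x).erase (-y) := by ext; grind
  have hT4 (h : -x ∉ S) : ((insert (-x) (S.erase (-y))).erase x).erase (-x) =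
      (S.erase x).erase (-y) := by ext; grind
  have hwA (h : y ∉ S) :=
    wLt_insert_erase hy hx hS (by omega : 1 ≤ i + 1) (by omega) hxS h
  have hwB (h : -x ∉ S) := wLt_insert_erase hx' hy' hS (by omega : 1 ≤ i) hi.le hyS' h
  by_cases hyS : y ∈ S <;> by_cases hxS' : -x ∈ S <;>
    simp [hyS, hxS', hxS, hyS', d1, d1.symm, d2, d3, d3.symm, d4, d4.symm, d5, d5.symm, hT1,
      hT3, hT4, shiftCoef, qv_inv_mul_cancel, qv_inv_mul_mul_cancel, hwA, hwB,
      hw, hax, hay, neg_qv_zpow_add_one, neg_qv_zpow_sub_one]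

/-! ### Assembling the commutation relations -/

lemma shiftCoef_congr {x y : ℤ} {S T : Finset ℤ} (hx : -x ∈ T ↔ -x ∈ S)
    (hy : -y ∈ T ↔ -y ∈ S) : shiftCoef x y T = shiftCoef x y S := by
  simp [shiftCoef, hx, hy]

lemma commute_add_sum {R ι : Type*} [Ring R] {s : Finset ι} {x y : R} {z : ι → R} {a b : ι}
    (ha : a ∈ s) (hb : b ∈ s) (hx : ∀ j ∈ s, j ≠ a → Commute x (z j))
    (hy : ∀ j ∈ s, j ≠ b → Commute y (z j)) (h : ⁅x, z a⁆ + ⁅y, z b⁆ = 0) :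
    Commute (x + y) (∑ j ∈ s, z j) := by
  have h1 := Finset.sum_eq_single_of_mem (f := fun j => x * z j - z j * x) a ha
    fun j hj hne => sub_eq_zero.2 (hx j hj hne).eq
  have h2 := Finset.sum_eq_single_of_mem (f := fun j => y * z j - z j * y) b hb
    fun j hj hne => sub_eq_zero.2 (hy j hj hne).eq
  rw [Ring.lie_def, Ring.lie_def, ← h1, ← h2] at h
  simp only [Finset.sum_sub_distrib, ← Finset.mul_sum, ← Finset.sum_mul] at h
  refine sub_eq_zero.1 (Eq.trans ?_ h)
  rw [add_mul, mul_add]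
  abel

lemma commute_shiftOp_add_Eop {n : ℕ} {i x y : ℤ} (h1 : 1 ≤ i) (hi : i < n)
    (hxy : x = i ∧ y = i + 1 ∨ x = -i ∧ y = -(i + 1)) :
    Commute (shiftOp n x y (shiftCoef x y) + shiftOp n (-y) (-x) (fun _ => 1)) (Eop n) := by
  have hy : y ∈ Iset n := mem_Iset.2 (by grind)
  have hx' : -x ∈ Iset n := mem_Iset.2 (by grind)
  have hax : |x| = i := by grind
  have hay : |y| = i + 1 := by grind
  rw [Eop_eq_sum]
  refine commute_add_sum (a := i) (b := i + 1) (Finset.mem_Icc.2 ⟨by omega, by omega⟩)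
    (Finset.mem_Icc.2 ⟨by omega, by omega⟩) (fun j hj hne => ?_) (fun j hj hne => ?_)
    (lie_shiftOp_pairInsertOp h1 hi hxy) <;> rw [Finset.mem_Icc] at hj
  · by_cases hji : j = i + 1
    · exact commute_shiftOp_pairInsertOp_target hy hj.1 hj.2 (by grind)
    · exact commute_shiftOp_pairInsertOp hy hj.1 hj.2 (by grind) (by grind) (by grind)
        (by grind) (fun _ => shiftCoef_congr (by grind) (by grind))
  · by_cases hji : j = i
    · exact commute_shiftOp_pairInsertOp_target hx' hj.1 hj.2 (by grind)
    · exact commute_shiftOp_pairInsertOp hx' hj.1 hj.2 (by grind) (by grind) (by grind)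
        (by grind) (fun _ => rfl)

lemma commute_shiftOp_add_Fop {n : ℕ} {i x y : ℤ} (h1 : 1 ≤ i) (hi : i < n)
    (hxy : x = i ∧ y = i + 1 ∨ x = -i ∧ y = -(i + 1)) :
    Commute (shiftOp n x y (shiftCoef x y) + shiftOp n (-y) (-x) (fun _ => 1)) (Fop n) := by
  have hy : y ∈ Iset n := mem_Iset.2 (by grind)
  have hx' : -x ∈ Iset n := mem_Iset.2 (by grind)
  have hax : |x| = i := by grind
  have hay : |y| = i + 1 := by grind
  rw [Fop_eq_sum]
  refine commute_add_sum (a := i + 1) (b := i) (Finset.mem_Icc.2 ⟨by omega, by omega⟩)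
    (Finset.mem_Icc.2 ⟨by omega, by omega⟩) (fun j hj hne => ?_) (fun j hj hne => ?_)
    (lie_shiftOp_pairEraseOp h1 hi hxy) <;> rw [Finset.mem_Icc] at hj
  · by_cases hji : j = i
    · exact commute_shiftOp_pairEraseOp_source hy (by grind)
    · exact commute_shiftOp_pairEraseOp (by grind) hy hj.1 hj.2 (by grind) (by grind)
        (by grind) (fun _ => shiftCoef_congr (by grind) (by grind))
  · by_cases hji : j = i + 1
    · exact commute_shiftOp_pairEraseOp_source hx' (by grind)
    · exact commute_shiftOp_pairEraseOp (by grind) hx' hj.1 hj.2 (by grind) (by grind)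
        (by grind) (fun _ => rfl)

lemma commute_shiftOp_neg_Eop {n : ℕ} {x : ℤ} (hx : x ≠ 0) (hxn : |x| = n) :
    Commute (shiftOp n x (-x) (fun _ => 1)) (Eop n) := by
  have hx' : -x ∈ Iset n := mem_Iset.2 (by grind)
  rw [Eop_eq_sum]
  refine Commute.sum_right _ _ _ fun j hj => ?_
  rw [Finset.mem_Icc] at hj
  by_cases hjn : j = n
  · exact commute_shiftOp_pairInsertOp_target hx' hj.1 hj.2 (by grind)
  · exact commute_shiftOp_pairInsertOp hx' hj.1 hj.2 (by grind) (by grind) (by grind)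
      (by grind) (fun _ => rfl)

lemma commute_shiftOp_neg_Fop {n : ℕ} {x : ℤ} (hx : x ≠ 0) (hxn : |x| = n) :
    Commute (shiftOp n x (-x) (fun _ => 1)) (Fop n) := by
  have hx' : -x ∈ Iset n := mem_Iset.2 (by grind)
  rw [Fop_eq_sum]
  refine Commute.sum_right _ _ _ fun j hj => ?_
  rw [Finset.mem_Icc] at hj
  by_cases hjn : j = n
  · exact commute_shiftOp_pairEraseOp_source hx' (by grind)
  · exact commute_shiftOp_pairEraseOp hx hx' hj.1 hj.2 (by grind) (by grind)
      (by grind) (fun _ => rfl)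

lemma kop_eq (n : ℕ) (i : ℤ) : kop n i = diagOp n (fun S => qv ^ alphaPair n i S) :=
  mkOp_smul_bv n fun S => qv ^ alphaPair n i S

lemma kinvop_eq (n : ℕ) (i : ℤ) : kinvop n i = diagOp n (fun S => qv ^ (-alphaPair n i S)) :=
  mkOp_smul_bv n fun S => qv ^ (-alphaPair n i S)

lemma Kop_eq (n : ℕ) : Kop n = diagOp n (fun S => (-qv) ^ wTot n S) :=
  mkOp_smul_bv n fun S => (-qv) ^ wTot n S

lemma Kinvop_eq (n : ℕ) : Kinvop n = diagOp n (fun S => (-qv) ^ (-wTot n S)) :=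
  mkOp_smul_bv n fun S => (-qv) ^ (-wTot n S)

lemma commute_shiftOp_Kop {n : ℕ} {x y : ℤ} (hy : y ∈ Iset n) (d : Finset ℤ → Fq) :
    Commute (shiftOp n x y d) (Kop n) := by
  rw [Kop_eq]
  exact (commute_diagOp_shiftOp hy fun S hS h h' => by rw [wTot_insert_erase hy hS h h']).symm

lemma commute_shiftOp_Kinvop {n : ℕ} {x y : ℤ} (hy : y ∈ Iset n) (d : Finset ℤ → Fq) :
    Commute (shiftOp n x y d) (Kinvop n) := by
  rw [Kinvop_eq]
  exact (commute_diagOp_shiftOp hy fun S hS h h' => by rw [wTot_insert_erase hy hS h h']).symm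

lemma commute_shiftOp_add {n : ℕ} {i x y : ℤ} (h1 : 1 ≤ i) (hi : i < n)
    (hxy : x = i ∧ y = i + 1 ∨ x = -i ∧ y = -(i + 1)) :
    ∀ b ∈ [Eop n, Fop n, Kop n, Kinvop n],
      Commute (shiftOp n x y (shiftCoef x y) + shiftOp n (-y) (-x) (fun _ => 1)) b := by
  have hy : y ∈ Iset n := mem_Iset.2 (by grind)
  have hx' : -x ∈ Iset n := mem_Iset.2 (by grind)
  simp only [List.forall_mem_cons, List.not_mem_nil, false_implies, implies_true, and_true]
  exact ⟨commute_shiftOp_add_Eop h1 hi hxy, commute_shiftOp_add_Fop h1 hi hxy,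
    (commute_shiftOp_Kop hy _).add_left (commute_shiftOp_Kop hx' _),
    (commute_shiftOp_Kinvop hy _).add_left (commute_shiftOp_Kinvop hx' _)⟩

lemma commute_shiftOp_neg {n : ℕ} {x : ℤ} (hx : x ≠ 0) (hxn : |x| = n) :
    ∀ b ∈ [Eop n, Fop n, Kop n, Kinvop n], Commute (shiftOp n x (-x) (fun _ => 1)) b := by
  have hx' : -x ∈ Iset n := mem_Iset.2 (by grind)
  simp only [List.forall_mem_cons, List.not_mem_nil, false_implies, implies_true, and_true]
  exact ⟨commute_shiftOp_neg_Eop hx hxn, commute_shiftOp_neg_Fop hx hxn,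
    commute_shiftOp_Kop hx' _, commute_shiftOp_Kinvop hx' _⟩

lemma commute_diagOp {n : ℕ} {c : Finset ℤ → Fq}
    (hE : ∀ (j : ℤ) (S : Finset ℤ), j ∉ S → -j ∉ S → c (insert j (insert (-j) S)) = c S)
    (hF : ∀ (j : ℤ) (S : Finset ℤ), j ∈ S → -j ∈ S → c ((S.erase j).erase (-j)) = c S) :
    ∀ b ∈ [Eop n, Fop n, Kop n, Kinvop n], Commute (diagOp n c) b := by
  simp only [List.forall_mem_cons, List.not_mem_nil, false_implies, implies_true, and_true,
    Kop_eq, Kinvop_eq]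
  exact ⟨commute_diagOp_Eop hE, commute_diagOp_Fop hF, commute_diagOp_diagOp _ _,
    commute_diagOp_diagOp _ _⟩

/-- each of e_i, f_i, k_i^{±1} (i ∈ {1,…,n}) commutes with each of E, F, K^{±1}. -/
theorem stmt4 (n : ℕ) (hn : 1 ≤ n) :
    ∀ i ∈ Finset.Icc (1 : ℤ) (n : ℤ),
      ∀ a ∈ [eop n i, fop n i, kop n i, kinvop n i],
        ∀ b ∈ [Eop n, Fop n, Kop n, Kinvop n], Commute a b := by
  intro i hi a ha
  rw [Finset.mem_Icc] at hi
  simp only [List.mem_cons, List.not_mem_nil, or_false] at ha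
  rcases ha with rfl | rfl | rfl | rfl
  · rcases hi.2.lt_or_eq with h | rfl
    · rw [eop_eq_of_lt hi.1 h]
      exact commute_shiftOp_add hi.1 h (Or.inr ⟨rfl, rfl⟩)
    · rw [eop_last]
      exact commute_shiftOp_neg (by omega) (by simp)
  · rcases hi.2.lt_or_eq with h | rfl
    · rw [fop_eq_of_lt hi.1 h]
      exact commute_shiftOp_add hi.1 h (Or.inl ⟨rfl, rfl⟩)
    · rw [fop_last]
      exact commute_shiftOp_neg (by omega) (by simp)
  · rw [kop_eq]
    exact commute_diagOp (fun j S h h' => by rw [alphaPair_insert_pair h h'])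
      (fun j S h h' => by rw [alphaPair_erase_pair h h'])
  · rw [kinvop_eq]
    exact commute_diagOp (fun j S h h' => by rw [alphaPair_insert_pair h h'])
      (fun j S h h' => by rw [alphaPair_erase_pair h h'])

end
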